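/- Let r, q₁, q₂ ∈ F₂[x] be squarefree and b ∈ (F₂[x]/(r))^×. Then |Σ e(a₁/q₁)| ≤ 2τ(r), where the sum runs over pairs (a₁, a₂) with a_i ∈ (F₂[x]/(q_i))^× and a₁/q₁ + a₂/q₂ ≡ b/r (mod F₂[x]). -/

import Mathlib

open Polynomial
open scoped Classical

noncomputable section

abbrev F2 := ZMod 2
abbrev Kinf := LaurentSeries F2
def polyToK (f : F2[X]) : Kinf :=
  ∑ i ∈ f.support, HahnSeries.single (-(i : ℤ)) (f.coeff i)
def ordK (a : Kinf) : WithBot ℤ := if a = 0 then ⊥ else (↑(-a.order) : WithBot ℤ)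
def eKr (a : Kinf) : ℝ := (-1 : ℝ) ^ ((a.coeff 1).val)
def eK (a : Kinf) : ℂ := ((eKr a : ℝ) : ℂ)
def InT (θ : Kinf) : Prop := ordK θ ≤ ((-1 : ℤ) : WithBot ℤ)
def GN (N : ℕ) : Finset F2[X] :=
  Set.Finite.toFinset (s := {f : F2[X] | f.degree < (N : ℕ)}) (by
    have h : {f : F2[X] | f.degree < (N : ℕ)} = ↑(Polynomial.degreeLT F2 N) := by
      ext f
      simp [Polynomial.mem_degreeLT]
    rw [h]
    have : Finite (Polynomial.degreeLT F2 N) :=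
      Finite.of_equiv _ (Polynomial.degreeLTEquiv F2 N).symm.toEquiv
    exact (Polynomial.degreeLT F2 N : Set F2[X]).toFinite)
def ratK (u s : F2[X]) : Kinf := polyToK u * (polyToK s)⁻¹

/-- τ(f): the number of divisors of `f`. -/
def tau (f : F2[X]) : ℕ := ((GN (f.natDegree + 1)).filter (fun g => g ∣ f)).card

/-- φ(f): the number of invertible residues modulo `f`. -/
def phi (f : F2[X]) : ℕ := ((GN f.natDegree).filter (fun g => IsCoprime g f)).card

/-- ω(f): the number of (irreducible nonconstant, i.e. prime) divisors of `f`. -/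
def omegaP (f : F2[X]) : ℕ :=
  ((GN (f.natDegree + 1)).filter (fun r => Irreducible r ∧ r ∣ f)).card

/-- The Möbius function on `F₂[x]`. -/
def mu (f : F2[X]) : ℤ := if Squarefree f then (-1) ^ (omegaP f) else 0

/-- The set of invertible residues modulo `s` (canonical representatives of
`(F₂[x]/(s))^×`, i.e. polynomials of degree `< deg s` coprime to `s`). -/
def residues (s : F2[X]) : Finset F2[X] := (GN s.natDegree).filter (fun t => IsCoprime t s)

/-- `α(s) = μ(s)/φ(s)`. -/
def alphaA (s : F2[X]) : ℝ := (mu s : ℝ) / (phi s : ℝ)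

/-- `α'(s) = ∏_{r | s prime} 3/(2^{deg r}+3)` for `s` squarefree, `0` otherwise. -/
def alphaB (s : F2[X]) : ℝ :=
  if Squarefree s then
    ∏ r ∈ (GN (s.natDegree + 1)).filter (fun r => Irreducible r ∧ r ∣ s),
      (3 : ℝ) / ((2 : ℝ) ^ r.natDegree + 3)
  else 0

/-- `Λ_M(f) = Σ_{s ∈ G_M} α(s) Σ_{t ∈ (F₂[x]/(s))^×} e(f t s⁻¹)`. -/
def LambdaM (M : ℕ) (f : F2[X]) : ℝ :=
  ∑ s ∈ GN M, alphaA s * ∑ t ∈ residues s, eKr (polyToK f * ratK t s)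

/-- `H_M(f) = Σ_{s ∈ G_M} α'(s) Σ_{t ∈ (F₂[x]/(s))^×} e(f t s⁻¹)`. -/
def HM (M : ℕ) (f : F2[X]) : ℝ :=
  ∑ s ∈ GN M, alphaB s * ∑ t ∈ residues s, eKr (polyToK f * ratK t s)

/-- `Λ'(f) = deg f` if `f` is prime, `0` otherwise. -/
def LambdaP (f : F2[X]) : ℝ := if Irreducible f then (f.natDegree : ℝ) else 0

/-- `Ψ(f) = Λ'(f+1) H_Q(f) 1_{f ∈ G_N}`. -/
def Psi (N Q : ℕ) (f : F2[X]) : ℝ :=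
  LambdaP (f + 1) * HM Q f * (if f ∈ GN N then 1 else 0)

/-- `Ψ'(f) = Λ_R(f+1) H_Q(f) 1_{f ∈ G_N}`. -/
def Psi' (N R Q : ℕ) (f : F2[X]) : ℝ :=
  LambdaM R (f + 1) * HM Q f * (if f ∈ GN N then 1 else 0)

/-- `Λ_r(f)` for a single prime `r`. -/
def Lambda_r (r f : F2[X]) : ℝ :=
  if r ∣ f then 0 else (2 : ℝ) ^ r.natDegree / ((2 : ℝ) ^ r.natDegree - 1)

/-- `τ²_r(f)` for a single prime `r`. -/
def tauSq_r (r f : F2[X]) : ℝ :=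
  if r ∣ f then 4 * (2 : ℝ) ^ r.natDegree / ((2 : ℝ) ^ r.natDegree + 3)
  else (2 : ℝ) ^ r.natDegree / ((2 : ℝ) ^ r.natDegree + 3)

/-- `˜Λ_M(f) = ∏_{r ∈ G_M prime} Λ_r(f)`. -/
def LambdaTilde (M : ℕ) (f : F2[X]) : ℝ :=
  ∏ r ∈ (GN M).filter (fun r => Irreducible r), Lambda_r r f

/-- `˜H_M(f) = ∏_{r ∈ G_M prime} τ²_r(f)`. -/
def HTilde (M : ℕ) (f : F2[X]) : ℝ :=
  ∏ r ∈ (GN M).filter (fun r => Irreducible r), tauSq_r r f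

/-- The element of `K∞` determined by a rational function (with `x ↦ t⁻¹`). -/
def ratToK (l : RatFunc F2) : Kinf := polyToK l.num * (polyToK l.denom)⁻¹

/-- `c : F₂(x)/F₂[x] → ℝ` (encoded on the canonical representatives
`λ = num/denom` in lowest terms with `deg num < deg denom`) is the system of Fourier
coefficients of `F : F₂[x] → ℝ`, i.e. `F(f) = Σ_λ c(λ) e(λ f)`. -/
def IsFourierCoeffs (F : F2[X] → ℝ) (c : RatFunc F2 → ℝ) : Prop :=
  (Function.support c).Finite ∧
  (∀ l : RatFunc F2, c l ≠ 0 → (l.num).degree < (l.denom).degree) ∧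
  ∀ f : F2[X], F f = ∑ᶠ l : RatFunc F2, c l * eKr (ratToK l * polyToK f)

/-- The canonical representative (mod `F₂[x]`) of a rational function. -/
def fracRat (l : RatFunc F2) : RatFunc F2 :=
  l - algebraMap F2[X] (RatFunc F2) (l.num / l.denom)

/-- `c(n, η)` from the statement of the exponential sum estimate for `Λ'`. -/
def cFun (n : ℕ) (η : Kinf) : ℝ :=
  if ordK η < ((-(n : ℤ) - 1 : ℤ) : WithBot ℤ) then 1
  else if ordK η = ((-(n : ℤ) - 1 : ℤ) : WithBot ℤ) then -1
  else 0

/-- The class `C_B(X)` (with explicit implied constant `Cst`): functions whose Fourier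
coefficients are supported on `λ` with squarefree denominator of degree `≤ X` and satisfy
`|c(λ)| ≤ Cst · τ(denom λ)^B / 2^{deg (denom λ)}`. -/
def InClassC (B X : ℕ) (Cst : ℝ) (F : F2[X] → ℝ) : Prop :=
  ∃ c : RatFunc F2 → ℝ, IsFourierCoeffs F c ∧
    (∀ l : RatFunc F2, c l ≠ 0 → Squarefree l.denom ∧ (l.denom).natDegree ≤ X) ∧
    (∀ l : RatFunc F2, |c l| ≤ Cst * (tau l.denom : ℝ) ^ B / 2 ^ (l.denom).natDegree)

/-- The fractional part `‖θ‖` of `θ ∈ K∞`: keep exactly the coefficients of `x^{-n}`, `n ≥ 1`. -/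
def fracK (θ : Kinf) : Kinf :=
  ⟨fun n => if 1 ≤ n then θ.coeff n else 0, by
    apply θ.isPWO_support'.mono
    intro n hn
    simp only [Function.mem_support, ne_eq] at hn ⊢
    intro h
    apply hn
    split_ifs
    · exact h
    · rfl⟩


/-! ### The embedding `polyToK` -/

def polyHom : F2[X] →+* Kinf :=
  Polynomial.eval₂RingHom (HahnSeries.C : F2 →+* Kinf) (HahnSeries.single (-1 : ℤ) (1 : F2))

theorem polyToK_eq (f : F2[X]) : polyToK f = polyHom f := by
  unfold polyToK polyHom
  rw [Polynomial.coe_eval₂RingHom, Polynomial.eval₂_eq_sum, Polynomial.sum]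
  refine Finset.sum_congr rfl fun i _ => ?_
  rw [HahnSeries.single_pow, HahnSeries.C_apply, HahnSeries.single_mul_single]
  simp

theorem polyToK_coeff (f : F2[X]) (n : ℕ) : (polyToK f).coeff (-(n : ℤ)) = f.coeff n := by
  unfold polyToK
  rw [HahnSeries.coeff_sum]
  simp only [HahnSeries.coeff_single, neg_inj, Nat.cast_inj]
  simp
  exact fun h => h.symm

theorem polyToK_coeff_pos (f : F2[X]) (n : ℤ) (hn : 0 < n) : (polyToK f).coeff n = 0 := by
  unfold polyToK
  rw [HahnSeries.coeff_sum]
  refine Finset.sum_eq_zero fun i _ => ?_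
  rw [HahnSeries.coeff_single, if_neg (by lia)]

theorem polyToK_ne_zero {f : F2[X]} (hf : f ≠ 0) : polyToK f ≠ 0 := by
  intro h
  have := polyToK_coeff f f.natDegree
  rw [h] at this
  simp at this
  exact hf (Polynomial.leadingCoeff_eq_zero.mp this.symm)

theorem polyToK_order {f : F2[X]} (hf : f ≠ 0) : (polyToK f).order = -(f.natDegree : ℤ) := by
  apply le_antisymm
  · apply HahnSeries.order_le_of_coeff_ne_zero
    rw [polyToK_coeff]
    simpa using hf
  · rw [HahnSeries.le_order_iff_forall (polyToK_ne_zero hf)]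
    intro j hj
    have h2 := polyToK_coeff f (-j).toNat
    rw [show -(((-j).toNat : ℕ) : ℤ) = j by lia] at h2
    rw [h2]
    apply Polynomial.coeff_eq_zero_of_natDegree_lt
    lia

/-- The additive functional `c ↦ coefficient of x⁻¹ in c/m`. -/
def resHom (m : F2[X]) : F2[X] →+ F2 where
  toFun c := (ratK c m).coeff 1
  map_zero' := by simp [ratK, polyToK_eq]
  map_add' a b := by simp [ratK, polyToK_eq, add_mul]

theorem resHom_dvd {m c : F2[X]} (hm : m ≠ 0) (h : m ∣ c) : resHom m c = 0 := by
  obtain ⟨g, rfl⟩ := h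
  show (ratK (m * g) m).coeff 1 = 0
  have h0 := polyToK_ne_zero hm
  have : ratK (m * g) m = polyToK g := by
    unfold ratK
    rw [polyToK_eq (m * g), map_mul, ← polyToK_eq, ← polyToK_eq]
    field_simp
  rw [this]
  exact polyToK_coeff_pos g 1 one_pos

theorem ratK_mul_right {a q k : F2[X]} (hk : k ≠ 0) :
    ratK (a * k) (q * k) = ratK a q := by
  have h0 := polyToK_ne_zero hk
  unfold ratK
  rw [polyToK_eq (a * k), polyToK_eq (q * k), map_mul, map_mul, ← polyToK_eq, ← polyToK_eq,
    ← polyToK_eq, mul_inv, mul_mul_mul_comm, mul_inv_cancel₀ h0, mul_one]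

theorem resHom_X_pow {p : F2[X]} (hp : p ≠ 0) (hd : 1 ≤ p.natDegree) :
    resHom p (X ^ (p.natDegree - 1)) ≠ 0 := by
  show (ratK _ p).coeff 1 ≠ 0
  have h0 := polyToK_ne_zero hp
  have hX : (X ^ (p.natDegree - 1) : F2[X]) ≠ 0 := by simp
  have h1 : ratK (X ^ (p.natDegree - 1)) p ≠ 0 :=
    mul_ne_zero (polyToK_ne_zero hX) (inv_ne_zero h0)
  have h2 : (ratK (X ^ (p.natDegree - 1)) p).order = 1 := by
    have h3 : ratK (X ^ (p.natDegree - 1)) p * polyToK p = polyToK (X ^ (p.natDegree - 1)) := by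
      unfold ratK
      rw [inv_mul_cancel_right₀ h0]
    have h4 := congrArg HahnSeries.order h3
    rw [HahnSeries.order_mul h1 h0, polyToK_order hp, polyToK_order hX, natDegree_X_pow] at h4
    lia
  rw [← h2]
  exact fun h => h1 (HahnSeries.coeff_order_eq_zero.mp h)

/-! ### The sign character of `F₂` -/

def chi (a : F2) : ℝ := (-1 : ℝ) ^ a.val

theorem chi_add (a b : F2) : chi (a + b) = chi a * chi b := by
  have h : ∀ a b : F2, ((a + b).val % 2) = (a.val + b.val) % 2 := by decide
  unfold chi
  rw [← pow_add, neg_one_pow_eq_pow_mod_two, h, ← neg_one_pow_eq_pow_mod_two]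

theorem chi_zero : chi 0 = 1 := by simp [chi]

theorem chi_abs (a : F2) : |chi a| = 1 := by simp [chi]

theorem chi_ne {a : F2} (h : a ≠ 0) : chi a ≠ 1 := by
  have h1 : ∀ a : F2, a ≠ 0 → a = 1 := by decide
  have : a = 1 := h1 a h
  subst this
  unfold chi
  norm_num [ZMod.val_one]

theorem chi_sum {ι : Type*} (s : Finset ι) (f : ι → F2) :
    chi (∑ i ∈ s, f i) = ∏ i ∈ s, chi (f i) := by
  induction s using Finset.induction_on with
  | empty => simp [chi_zero]
  | insert a s ha ih => rw [Finset.sum_insert ha, Finset.prod_insert ha, chi_add, ih]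

theorem chi_total {K : Type*} [AddCommGroup K] [Fintype K] (φ : K →+ F2) (hφ : ∃ x, φ x ≠ 0) :
    ∑ x, chi (φ x) = 0 := by
  obtain ⟨y, hy⟩ := hφ
  have h : ∑ x, chi (φ x) = chi (φ y) * ∑ x, chi (φ x) := by
    rw [Finset.mul_sum, ← Equiv.sum_comp (Equiv.addLeft y)]
    simp [chi_add]
  have h2 := chi_ne hy
  have h3 : (chi (φ y) - 1) * ∑ x, chi (φ x) = 0 := by linarith
  rcases mul_eq_zero.mp h3 with h4 | h4
  · exact absurd (by linarith) h2
  · exact h4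

theorem chi_sum_le {K : Type*} (φ : K → F2) (A : Finset K) :
    |∑ x ∈ A, chi (φ x)| ≤ A.card := by
  refine (Finset.abs_sum_le_sum_abs _ _).trans ?_
  simp [chi_abs]

theorem local_bound {K : Type*} [AddCommGroup K] [Fintype K] (φ : K →+ F2)
    (hφ : ∃ x, φ x ≠ 0) (B : K) (s₁ s₂ : Prop) :
    |∑ x ∈ Finset.univ.filter (fun x : K => (x = 0 ↔ s₁) ∧ (x = B ↔ s₂)), chi (φ x)| ≤
      if B = 0 then 1 else 2 := by
  have hcard : ((({0, B} : Finset K).card : ℕ) : ℝ) ≤ if B = 0 then 1 else 2 := by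
    split_ifs with h
    · subst h; simp
    · exact_mod_cast Finset.card_le_two
  refine le_trans ?_ hcard
  by_cases hs : s₁ ∨ s₂
  · refine (chi_sum_le _ _).trans ?_
    exact_mod_cast Finset.card_le_card (by
      intro x hx
      simp only [Finset.mem_filter, Finset.mem_univ, true_and] at hx
      simp only [Finset.mem_insert, Finset.mem_singleton]
      tauto)
  · have : Finset.univ.filter (fun x : K => (x = 0 ↔ s₁) ∧ (x = B ↔ s₂)) = ({0, B} : Finset K)ᶜ := by
      ext x
      simp only [Finset.mem_filter, Finset.mem_univ, true_and, Finset.mem_compl,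
        Finset.mem_insert, Finset.mem_singleton]
      tauto
    rw [this]
    have h2 := Finset.sum_add_sum_compl ({0, B} : Finset K) (fun x => chi (φ x))
    rw [chi_total φ hφ] at h2
    rw [show ∑ x ∈ ({0, B} : Finset K)ᶜ, chi (φ x) = - ∑ x ∈ ({0, B} : Finset K), chi (φ x) by
      linarith, abs_neg]
    exact chi_sum_le _ _

/-! ### `2^ω(r) ≤ τ(r)` -/

theorem mem_GN {N : ℕ} {f : F2[X]} : f ∈ GN N ↔ f.degree < (N : ℕ) := by
  simp [GN]

theorem two_pow_le_tau {r : F2[X]} (hr : r ≠ 0) (S : Finset F2[X])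
    (hS : ∀ p ∈ S, Irreducible p ∧ p ∣ r) : 2 ^ S.card ≤ tau r := by
  have hassoc : ∀ p q : F2[X], p ≠ 0 → Associated p q → p = q := by
    intro p q hp h
    have hm : ∀ f : F2[X], f ≠ 0 → f.Monic := by
      intro f hf
      have h1 : f.leadingCoeff ≠ 0 := by simpa using hf
      have : ∀ a : F2, a ≠ 0 → a = 1 := by decide
      exact this _ h1
    exact Polynomial.eq_of_monic_of_associated (hm p hp) (hm q (fun h' => hp (by
      rw [h'] at h; exact (associated_zero_iff_eq_zero _).mp h))) h
  have hmem : ∀ A ⊆ S, ∀ p ∈ S, p ∣ ∏ q ∈ A, q → p ∈ A := by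
    intro A hA p hp hd
    obtain ⟨q, hq, hpq⟩ := (hS p hp).1.prime.exists_mem_finset_dvd hd
    have := (hS p hp).1.associated_of_dvd (hS q (hA hq)).1 hpq
    rw [hassoc p q (hS p hp).1.ne_zero this]
    exact hq
  rw [← Finset.card_powerset, tau]
  refine Finset.card_le_card_of_injOn (fun A => ∏ q ∈ A, q) ?_ ?_
  · intro A hA
    have hA : A ⊆ S := by simpa using hA
    have hsub : Subsingleton F2[X]ˣ := ⟨fun u v => Units.ext
      (hassoc _ _ u.isUnit.ne_zero ((associated_one_iff_isUnit.mpr u.isUnit).trans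
        (associated_one_iff_isUnit.mpr v.isUnit).symm))⟩
    have hd : ∏ q ∈ A, q ∣ r := by
      refine Finset.prod_primes_dvd r (fun q hq => (hS q (hA hq)).1.prime)
        (fun q hq => (hS q (hA hq)).2)
    simp only [Finset.coe_filter, Set.mem_ofPred_eq, mem_GN]
    refine ⟨?_, hd⟩
    refine lt_of_le_of_lt (Polynomial.degree_le_of_dvd hd hr) ?_
    rw [Polynomial.degree_eq_natDegree hr]
    exact_mod_cast Nat.lt_succ_self _
  · intro A hA A' hA' h
    have hA : A ⊆ S := by simpa using hA
    have hA' : A' ⊆ S := by simpa using hA'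
    simp only at h
    ext p
    constructor
    · intro hp
      exact hmem A' hA' p (hA hp) (h ▸ Finset.dvd_prod_of_mem _ hp)
    · intro hp
      exact hmem A hA p (hA' hp) (h ▸ Finset.dvd_prod_of_mem (fun q => q) hp)

theorem finite_quot {p : F2[X]} (hp : p ≠ 0) : Finite (F2[X] ⧸ Ideal.span {p}) := by
  have : Module.Finite F2 (AdjoinRoot p) := (AdjoinRoot.powerBasis hp).finite
  exact (Module.finite_of_finite F2 : Finite (AdjoinRoot p))

/-! ### The global bound -/

theorem monic_of_ne_zero' {f : F2[X]} (hf : f ≠ 0) : f.Monic := by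
  have h1 : f.leadingCoeff ≠ 0 := by simpa using hf
  have : ∀ a : F2, a ≠ 0 → a = 1 := by decide
  exact this _ h1

theorem eq_of_irred_dvd {p q : F2[X]} (hp : Irreducible p) (hq : Irreducible q) (h : p ∣ q) :
    p = q :=
  Polynomial.eq_of_monic_of_associated (monic_of_ne_zero' hp.ne_zero)
    (monic_of_ne_zero' hq.ne_zero) (hp.associated_of_dvd hq h)

theorem coprime_of_ne {p q : F2[X]} (hp : Irreducible p) (hq : Irreducible q) (h : p ≠ q) :
    IsCoprime p q :=
  (Irreducible.coprime_iff_not_dvd hp).mpr fun hd => h (eq_of_irred_dvd hp hq hd)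

theorem prod_dvd_of_forall {P : Finset F2[X]} (hP : ∀ p ∈ P, Irreducible p) {c : F2[X]}
    (h : ∀ p ∈ P, p ∣ c) : ∏ p ∈ P, p ∣ c :=
  Finset.prod_dvd_of_coprime
    (fun p hp q hq hne => coprime_of_ne (hP p hp) (hP q hq) hne) h

theorem global_bound {τ : Type*} (P : Finset F2[X]) (hP : ∀ p ∈ P, Irreducible p) (B : F2[X])
    (s₁ s₂ : F2[X] → Prop) (T : Finset τ) (c : τ → F2[X])
    (hc : ∀ t ∈ T, ∀ p ∈ P, (p ∣ c t ↔ s₁ p) ∧ (p ∣ c t - B ↔ s₂ p))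
    (hinj : ∀ t ∈ T, ∀ t' ∈ T, (∏ p ∈ P, p) ∣ c t - c t' → t = t')
    (hsurj : ∀ f : F2[X], (∀ p ∈ P, (p ∣ f ↔ s₁ p) ∧ (p ∣ f - B ↔ s₂ p)) →
      ∃ t ∈ T, (∏ p ∈ P, p) ∣ c t - f) :
    |∑ t ∈ T, chi (resHom (∏ p ∈ P, p) (c t))| ≤ ∏ p ∈ P, if p ∣ B then 1 else (2 : ℝ) := by
  set m := ∏ p ∈ P, p with hm
  have hm0 : m ≠ 0 := Finset.prod_ne_zero_iff.mpr fun p hp => (hP p hp).ne_zero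
  let I : {p // p ∈ P} → Ideal F2[X] := fun p => Ideal.span {p.1}
  have hcop : Pairwise (Function.onFun IsCoprime I) := by
    intro p q hpq
    exact (Ideal.isCoprime_span_singleton_iff _ _).mpr
      (coprime_of_ne (hP _ p.2) (hP _ q.2) fun h => hpq (Subtype.ext h))
  have hfin : ∀ p, Finite (F2[X] ⧸ I p) := fun p => finite_quot (hP _ p.2).ne_zero
  let _ : ∀ p, Fintype (F2[X] ⧸ I p) := fun p => Fintype.ofFinite _
  have hlift := Ideal.pi_quotient_surjective hcop
  choose L hL using hlift
  have hmk : ∀ (p : {p // p ∈ P}) (a b : F2[X]),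
      (Ideal.Quotient.mk (I p) a = Ideal.Quotient.mk (I p) b) ↔ p.1 ∣ a - b := by
    intro p a b
    rw [Ideal.Quotient.eq, Ideal.mem_span_singleton]
  have hmk0 : ∀ (p : {p // p ∈ P}) (a : F2[X]),
      (Ideal.Quotient.mk (I p) a = 0) ↔ p.1 ∣ a := by
    intro p a
    rw [Ideal.Quotient.eq_zero_iff_mem, Ideal.mem_span_singleton]
  let g : F2[X] → (∀ p, F2[X] ⧸ I p) := fun f p => Ideal.Quotient.mk (I p) f
  have hgL : ∀ x, g (L x) = x := fun x => funext fun p => hL x p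
  have hgdvd : ∀ a b, g a = g b → m ∣ a - b := by
    intro a b h
    refine prod_dvd_of_forall hP fun p hp => ?_
    exact (hmk ⟨p, hp⟩ a b).mp (congrFun h ⟨p, hp⟩)
  have hres : ∀ a b, m ∣ a - b → resHom m a = resHom m b := by
    intro a b h
    have := resHom_dvd hm0 h
    rw [map_sub] at this
    exact sub_eq_zero.mp this
  have hgadd : ∀ a b, g (a + b) = g a + g b := fun a b => funext fun p => map_add _ _ _
  let Φ : (∀ p, F2[X] ⧸ I p) →+ F2 := AddMonoidHom.mk' (fun x => resHom m (L x)) (by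
    intro x y
    rw [← map_add]
    apply hres
    apply hgdvd
    rw [hgadd, hgL, hgL, hgL])
  have hΦ : ∀ a, Φ (g a) = resHom m a := by
    intro a
    show resHom m (L (g a)) = _
    apply hres
    apply hgdvd
    rw [hgL]
  let φ : ∀ p, (F2[X] ⧸ I p) →+ F2 := fun p =>
    Φ.comp (AddMonoidHom.single (fun p => F2[X] ⧸ I p) p)
  have hφne : ∀ p, ∃ x, φ p x ≠ 0 := by
    intro p
    obtain ⟨k, hk⟩ := Finset.dvd_prod_of_mem (fun q : F2[X] => q) p.2
    have hmk' : m = p.1 * k := hk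
    have hk0 : k ≠ 0 := by
      rintro rfl
      exact hm0 (by rw [hmk', mul_zero])
    have hkq : ∀ q : {p // p ∈ P}, q ≠ p → q.1 ∣ k := by
      intro q hq
      have h1 : q.1 ∣ p.1 * k := hmk' ▸ Finset.dvd_prod_of_mem (fun q : F2[X] => q) q.2
      exact (coprime_of_ne (hP _ q.2) (hP _ p.2) fun h => hq (Subtype.ext h)).dvd_of_dvd_mul_left h1
    refine ⟨Ideal.Quotient.mk (I p) (X ^ (p.1.natDegree - 1) * k), ?_⟩
    have h2 : Pi.single p (Ideal.Quotient.mk (I p) (X ^ (p.1.natDegree - 1) * k)) =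
        g (X ^ (p.1.natDegree - 1) * k) := by
      funext q
      by_cases hq : q = p
      · subst hq
        simp [g]
      · rw [Pi.single_eq_of_ne hq]
        exact ((hmk0 q _).mpr ((hkq q hq).mul_left _)).symm
    show Φ (Pi.single p _) ≠ 0
    rw [h2, hΦ]
    show (ratK _ m).coeff 1 ≠ 0
    rw [hmk', ratK_mul_right hk0]
    exact resHom_X_pow (hP _ p.2).ne_zero (hP _ p.2).natDegree_pos
  have hΦsum : ∀ x, chi (Φ x) = ∏ p, chi (φ p (x p)) := by
    intro x
    rw [← chi_sum]
    congr 1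
    conv_lhs => rw [← Finset.univ_sum_single x]
    rw [map_sum]
    rfl
  let A : ∀ p, Finset (F2[X] ⧸ I p) := fun p =>
    Finset.univ.filter (fun x => (x = 0 ↔ s₁ p.1) ∧ (x = Ideal.Quotient.mk (I p) B ↔ s₂ p.1))
  have hmemA : ∀ f : F2[X], g f ∈ Fintype.piFinset A ↔
      ∀ p ∈ P, (p ∣ f ↔ s₁ p) ∧ (p ∣ f - B ↔ s₂ p) := by
    intro f
    rw [Fintype.mem_piFinset]
    simp only [A, Finset.mem_filter, Finset.mem_univ, true_and, g, hmk, hmk0]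
    exact Subtype.forall
  have hsum : ∑ t ∈ T, chi (resHom m (c t)) = ∑ x ∈ Fintype.piFinset A, chi (Φ x) := by
    refine Finset.sum_bij (fun t _ => g (c t)) ?_ ?_ ?_ ?_
    · intro t ht
      exact (hmemA _).mpr (hc t ht)
    · intro t ht t' ht' h
      exact hinj t ht t' ht' (hgdvd _ _ h)
    · intro x hx
      rw [← hgL x] at hx
      obtain ⟨t, ht, hd⟩ := hsurj (L x) ((hmemA _).mp hx)
      refine ⟨t, ht, ?_⟩
      rw [← hgL x]
      funext p
      exact (hmk p _ _).mpr ((Finset.dvd_prod_of_mem (fun q : F2[X] => q) p.2).trans hd)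
    · intro t ht
      rw [hΦ]
  rw [hsum]
  simp only [hΦsum]
  have hpr : ∑ x ∈ Fintype.piFinset A, ∏ p, chi (φ p (x p)) =
      ∏ p, ∑ y ∈ A p, chi (φ p y) := by
    rw [Finset.prod_univ_sum A (fun p y => chi (φ p y))]
  rw [hpr, Finset.abs_prod, ← Finset.prod_coe_sort P]
  refine Finset.prod_le_prod (fun _ _ => abs_nonneg _) fun p _ => ?_
  have := local_bound (φ p) (hφne p) (Ideal.Quotient.mk (I p) B) (s₁ p.1) (s₂ p.1)
  simp only [hmk0] at this
  convert this using 2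

/-! ### Residues -/

theorem squarefree_dvd {q f : F2[X]} (hq : Squarefree q)
    (h : ∀ p, Irreducible p → p ∣ q → p ∣ f) : q ∣ f := by
  have h1 : q ∣ UniqueFactorizationMonoid.radical q := hq.isRadical.dvd_radical hq.ne_zero
  refine h1.trans ?_
  have hmem : ∀ p ∈ UniqueFactorizationMonoid.primeFactors q, Irreducible p ∧ p ∣ q := by
    intro p hp
    rw [UniqueFactorizationMonoid.mem_primeFactors] at hp
    exact ⟨UniqueFactorizationMonoid.irreducible_of_normalized_factor p hp,
      UniqueFactorizationMonoid.dvd_of_mem_normalizedFactors hp⟩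
  exact prod_dvd_of_forall (fun p hp => (hmem p hp).1)
    (fun p hp => h p (hmem p hp).1 (hmem p hp).2)

theorem not_both {m q k p : F2[X]} (hm : Squarefree m) (h : m = q * k) (hp : Irreducible p)
    (h1 : p ∣ q) (h2 : p ∣ k) : False :=
  hp.not_isUnit (hm p (h ▸ mul_dvd_mul h1 h2))

theorem mem_residues {a q : F2[X]} :
    a ∈ residues q ↔ a.degree < (q.natDegree : ℕ) ∧ IsCoprime a q := by
  simp [residues, mem_GN]

theorem residues_unique {a a' q k m : F2[X]} (hm : m = q * k) (hm0 : m ≠ 0) (ha : a ∈ residues q)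
    (ha' : a' ∈ residues q) (h : m ∣ a * k - a' * k) : a = a' := by
  have hk : k ≠ 0 := by rintro rfl; simp [hm] at hm0
  have hq : q ≠ 0 := by rintro rfl; simp [hm] at hm0
  rw [hm, ← sub_mul] at h
  have h1 : q ∣ a - a' := (mul_dvd_mul_iff_right hk).mp h
  have h2 : (a - a').degree < q.degree := by
    rw [degree_eq_natDegree hq]
    exact lt_of_le_of_lt (degree_sub_le _ _)
      (max_lt (mem_residues.mp ha).1 (mem_residues.mp ha').1)
  exact sub_eq_zero.mp (eq_zero_of_dvd_of_degree_lt h1 h2)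

theorem residues_exists {q k m f : F2[X]} (hm : m = q * k) (hsq : Squarefree m)
    (h : ∀ p, Irreducible p → p ∣ m → (p ∣ f ↔ p ∣ k)) :
    ∃ a ∈ residues q, m ∣ a * k - f := by
  have hm0 : m ≠ 0 := hsq.ne_zero
  have hq : q ≠ 0 := by rintro rfl; simp [hm] at hm0
  have hkm : k ∣ m := ⟨q, by rw [hm, mul_comm]⟩
  have hk : k ∣ f := squarefree_dvd (hsq.squarefree_of_dvd hkm)
    fun p hp hpk => (h p hp (hpk.trans hkm)).mpr hpk
  obtain ⟨a, rfl⟩ := hk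
  have hmod : a % q = a - q * (a / q) := by
    rw [eq_sub_iff_add_eq, add_comm]
    exact EuclideanDomain.div_add_mod a q
  refine ⟨a % q, mem_residues.mpr ⟨?_, ?_⟩, ?_⟩
  · rw [← degree_eq_natDegree hq]
    exact EuclideanDomain.mod_lt a hq
  · refine isCoprime_of_irreducible_dvd (fun h => hq h.2) ?_
    intro z hz hza hzq
    have hza' : z ∣ a := by
      rw [hmod] at hza
      exact (dvd_sub_left (hzq.mul_right _)).mp hza
    have hzm : z ∣ m := hm ▸ hzq.mul_right _
    exact not_both hsq hm hz hzq ((h z hz hzm).mp (hza'.mul_left _))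
  · rw [hmod, hm]
    exact ⟨-(a / q), by ring⟩

theorem residues_dvd_iff {a q k m p : F2[X]} (hm : m = q * k) (ha : a ∈ residues q)
    (hp : Irreducible p) (hpm : p ∣ m) : p ∣ a * k ↔ p ∣ k := by
  refine ⟨fun h => ?_, fun h => h.mul_left _⟩
  by_contra hk
  have h1 : p ∣ a := (hp.prime.dvd_or_dvd h).resolve_right hk
  have h2 : p ∣ q := (hp.prime.dvd_or_dvd (hm ▸ hpm)).resolve_right hk
  exact hp.not_isUnit ((mem_residues.mp ha).2.isUnit_of_dvd' h1 h2)

theorem cond_iff {a₁ a₂ b q₁ q₂ r k₁ k₂ k₃ m : F2[X]} (hm0 : m ≠ 0) (h1 : m = q₁ * k₁)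
    (h2 : m = q₂ * k₂) (h3 : m = r * k₃) :
    (∃ g : F2[X],
          algebraMap F2[X] (RatFunc F2) a₁ / algebraMap F2[X] (RatFunc F2) q₁ +
              algebraMap F2[X] (RatFunc F2) a₂ / algebraMap F2[X] (RatFunc F2) q₂ -
            algebraMap F2[X] (RatFunc F2) b / algebraMap F2[X] (RatFunc F2) r =
          algebraMap F2[X] (RatFunc F2) g) ↔ m ∣ a₁ * k₁ + a₂ * k₂ - b * k₃ := by
  have hinj := RatFunc.algebraMap_injective F2
  have key : ∀ a q k : F2[X], m = q * k →
      algebraMap F2[X] (RatFunc F2) a / algebraMap F2[X] (RatFunc F2) q =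
        algebraMap F2[X] (RatFunc F2) (a * k) / algebraMap F2[X] (RatFunc F2) m := by
    intro a q k h
    have hk : k ≠ 0 := by rintro rfl; simp [h] at hm0
    rw [h, map_mul, map_mul, mul_div_mul_right]
    exact (map_ne_zero_iff _ hinj).mpr hk
  have hm' : algebraMap F2[X] (RatFunc F2) m ≠ 0 := (map_ne_zero_iff _ hinj).mpr hm0
  rw [key _ _ _ h1, key _ _ _ h2, key _ _ _ h3, ← add_div, ← sub_div, ← map_add, ← map_sub]
  refine exists_congr fun g => ?_
  rw [div_eq_iff hm', ← map_mul, hinj.eq_iff, mul_comm g m]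

/-- For `r, q₁, q₂` squarefree and `b ∈ (F₂[x]/(r))^×`, the sum of `e(a₁/q₁)` over pairs
`(a₁, a₂)` with `a_i ∈ (F₂[x]/(q_i))^×` and `a₁/q₁ + a₂/q₂ ≡ b/r (mod F₂[x])` has absolute
value at most `2τ(r)`. -/
theorem statement_15 (r q₁ q₂ : F2[X]) (hr : Squarefree r) (h1 : Squarefree q₁)
    (h2 : Squarefree q₂) (b : F2[X]) (hb : b ∈ residues r) :
    |∑ p ∈ (residues q₁ ×ˢ residues q₂).filter (fun p =>
        ∃ g : F2[X],
          algebraMap F2[X] (RatFunc F2) p.1 / algebraMap F2[X] (RatFunc F2) q₁ +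
              algebraMap F2[X] (RatFunc F2) p.2 / algebraMap F2[X] (RatFunc F2) q₂ -
            algebraMap F2[X] (RatFunc F2) b / algebraMap F2[X] (RatFunc F2) r =
          algebraMap F2[X] (RatFunc F2) g),
      eKr (ratK p.1 q₁)| ≤ 2 * (tau r : ℝ) := by
  have hn0 : q₁ * q₂ * r ≠ 0 := mul_ne_zero (mul_ne_zero h1.ne_zero h2.ne_zero) hr.ne_zero
  set P : Finset F2[X] := (GN ((q₁ * q₂ * r).natDegree + 1)).filter
    (fun p => Irreducible p ∧ p ∣ q₁ * q₂ * r) with hPdef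
  have hmemP : ∀ p, p ∈ P ↔ Irreducible p ∧ p ∣ q₁ * q₂ * r := by
    intro p
    rw [hPdef, Finset.mem_filter, mem_GN]
    refine ⟨fun h => h.2, fun h => ⟨?_, h⟩⟩
    refine lt_of_le_of_lt (Polynomial.degree_le_of_dvd h.2 hn0) ?_
    rw [Polynomial.degree_eq_natDegree hn0]
    exact_mod_cast Nat.lt_succ_self _
  have hP : ∀ p ∈ P, Irreducible p := fun p hp => ((hmemP p).mp hp).1
  obtain ⟨m, hm⟩ : ∃ m, m = ∏ p ∈ P, p := ⟨_, rfl⟩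
  have hPm : ∀ p ∈ P, p ∣ m := fun p hp => hm ▸ Finset.dvd_prod_of_mem (fun q : F2[X] => q) hp
  have hmP : ∀ p, Irreducible p → p ∣ m → p ∈ P := by
    intro p hp hd
    rw [hm] at hd
    obtain ⟨q, hq, hpq⟩ := hp.prime.exists_mem_finset_dvd hd
    rw [eq_of_irred_dvd hp (hP q hq) hpq]
    exact hq
  have hm0 : m ≠ 0 := hm ▸ Finset.prod_ne_zero_iff.mpr fun p hp => (hP p hp).ne_zero
  have hsq : Squarefree m := by
    rw [hm]
    refine Finset.squarefree_prod_of_pairwise_isCoprime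
      (fun p hp q hq hne => (coprime_of_ne (hP p hp) (hP q hq) hne).isRelPrime)
      (fun p hp => (hP p hp).squarefree)
  have hdvd : ∀ q, Squarefree q → q ∣ q₁ * q₂ * r → q ∣ m := fun q hq hd =>
    squarefree_dvd hq fun p hp hpq => hPm p ((hmemP p).mpr ⟨hp, hpq.trans hd⟩)
  obtain ⟨k₁, hk1⟩ := hdvd q₁ h1 ⟨q₂ * r, by ring⟩
  obtain ⟨k₂, hk2⟩ := hdvd q₂ h2 ⟨q₁ * r, by ring⟩
  obtain ⟨k₃, hk3⟩ := hdvd r hr ⟨q₁ * q₂, by ring⟩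
  have hk10 : k₁ ≠ 0 := by rintro rfl; simp [hk1] at hm0
  have hT : (residues q₁ ×ˢ residues q₂).filter (fun p =>
        ∃ g : F2[X],
          algebraMap F2[X] (RatFunc F2) p.1 / algebraMap F2[X] (RatFunc F2) q₁ +
              algebraMap F2[X] (RatFunc F2) p.2 / algebraMap F2[X] (RatFunc F2) q₂ -
            algebraMap F2[X] (RatFunc F2) b / algebraMap F2[X] (RatFunc F2) r =
          algebraMap F2[X] (RatFunc F2) g) =
      (residues q₁ ×ˢ residues q₂).filter (fun p => m ∣ p.1 * k₁ + p.2 * k₂ - b * k₃) :=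
    Finset.filter_congr fun p _ => cond_iff hm0 hk1 hk2 hk3
  rw [hT]
  have hmT : ∀ p : F2[X] × F2[X], p ∈ (residues q₁ ×ˢ residues q₂).filter
      (fun p => m ∣ p.1 * k₁ + p.2 * k₂ - b * k₃) ↔
      (p.1 ∈ residues q₁ ∧ p.2 ∈ residues q₂) ∧ m ∣ p.1 * k₁ + p.2 * k₂ - b * k₃ := by
    intro p
    rw [Finset.mem_filter, Finset.mem_product]
  have hterm : ∀ p : F2[X] × F2[X], eKr (ratK p.1 q₁) = chi (resHom m (p.1 * k₁)) := by
    intro p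
    show _ = chi ((ratK (p.1 * k₁) m).coeff 1)
    rw [hk1, ratK_mul_right hk10]
    rfl
  simp only [hterm]
  have hmain := global_bound P hP (b * k₃) (fun p => p ∣ k₁) (fun p => p ∣ k₂)
    ((residues q₁ ×ˢ residues q₂).filter (fun p => m ∣ p.1 * k₁ + p.2 * k₂ - b * k₃))
    (fun p => p.1 * k₁) ?_ ?_ ?_
  · rw [← hm] at hmain
    refine hmain.trans ?_
    have hprod : ∏ p ∈ P, (if p ∣ b * k₃ then 1 else (2 : ℝ)) =
        2 ^ (P.filter (fun p => ¬ p ∣ b * k₃)).card := by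
      rw [Finset.prod_ite]
      simp
    rw [hprod]
    have htau := two_pow_le_tau hr.ne_zero (P.filter (fun p => ¬ p ∣ b * k₃)) (by
      intro p hp
      rw [Finset.mem_filter] at hp
      refine ⟨hP p hp.1, ?_⟩
      have h5 : p ∣ r * k₃ := hk3 ▸ hPm p hp.1
      exact ((hP p hp.1).prime.dvd_or_dvd h5).resolve_right fun h6 => hp.2 (h6.mul_left _))
    have htau' : (2 : ℝ) ^ (P.filter (fun p => ¬ p ∣ b * k₃)).card ≤ (tau r : ℝ) := by
      exact_mod_cast htau
    have : (0 : ℝ) ≤ (tau r : ℝ) := Nat.cast_nonneg _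
    linarith
  · intro t ht p hp
    obtain ⟨⟨ht1, ht2⟩, ht3⟩ := (hmT t).mp ht
    refine ⟨residues_dvd_iff hk1 ht1 (hP p hp) (hPm p hp), ?_⟩
    rw [← residues_dvd_iff hk2 ht2 (hP p hp) (hPm p hp)]
    have h5 : p ∣ (t.1 * k₁ - b * k₃) + t.2 * k₂ := by
      have := (hPm p hp).trans ht3
      rwa [show t.1 * k₁ + t.2 * k₂ - b * k₃ = (t.1 * k₁ - b * k₃) + t.2 * k₂ by ring] at this
    exact ⟨fun h => (dvd_add_right h).mp h5, fun h => (dvd_add_left h).mp h5⟩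
  · intro t ht t' ht' hd
    rw [← hm] at hd
    obtain ⟨⟨ht1, ht2⟩, ht3⟩ := (hmT t).mp ht
    obtain ⟨⟨ht1', ht2'⟩, ht3'⟩ := (hmT t').mp ht'
    have e1 := residues_unique hk1 hm0 ht1 ht1' hd
    have e2 : t.2 = t'.2 := by
      refine residues_unique hk2 hm0 ht2 ht2' ?_
      have h6 := dvd_sub ht3 ht3'
      rw [e1] at h6
      rwa [show t'.1 * k₁ + t.2 * k₂ - b * k₃ - (t'.1 * k₁ + t'.2 * k₂ - b * k₃) =
        t.2 * k₂ - t'.2 * k₂ by ring] at h6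
    exact Prod.ext e1 e2
  · intro f hf
    rw [← hm]
    obtain ⟨a₁, ha1, hd1⟩ := residues_exists (f := f) hk1 hsq
      fun p hp hpm => (hf p (hmP p hp hpm)).1
    obtain ⟨a₂, ha2, hd2⟩ := residues_exists (f := b * k₃ - f) hk2 hsq
      fun p hp hpm => (dvd_sub_comm).trans (hf p (hmP p hp hpm)).2
    refine ⟨(a₁, a₂), (hmT _).mpr ⟨⟨ha1, ha2⟩, ?_⟩, hd1⟩
    have h6 := dvd_add hd1 hd2
    rwa [show a₁ * k₁ - f + (a₂ * k₂ - (b * k₃ - f)) = a₁ * k₁ + a₂ * k₂ - b * k₃ by ring] at h6
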